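/- Let G = (A ∪ B, E) be as above, let (M, ⟨P1,P2,P3⟩) be well-structured, extend M to the A-complete matching M̂ using dummy last-resort posts, and label all non-M̂ edges with the applicants' votes. Then for every matching M' of G, in every even-length alternating path of M̂ ⊕ M' the number of edges labeled −1 is at least the number of edges labeled +1; moreover, if one endpoint of the path is a dummy last-resort post, then the number of edges labeled −1 is at least one plus the number of edges labeled +1. -/

import Mathlib

open Classical

noncomputable section

variable {A B : Type*}

/-- A matching in the bipartite graph `G = (A ∪ B, E)`, represented as a partial
function assigning to each applicant `a ∈ A` its partner post (if any). -/
def IsMatching (E : A → B → Prop) (M : A → Option B) : Prop :=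
  (∀ a b, M a = some b → E a b) ∧ ∀ a a' b, M a = some b → M a' = some b → a = a'

/-- Post `b` is matched in `M`. -/
def PostMatched (M : A → Option B) (b : B) : Prop := ∃ a, M a = some b

/-- Applicant `a` prefers matching `M` to `M'` (lower rank = more preferred);
an applicant prefers being matched to being unmatched. -/
def APrefers (rank : A → B → ℕ) (M M' : A → Option B) (a : A) : Prop :=
  match M a, M' a with
  | some _, none => True
  | some b, some b' => rank a b < rank a b'
  | none, _ => False

/-- In the model where each post puts all its neighbors into a single tie,
post `b` prefers `M` to `M'` iff it is matched in `M` and unmatched in `M'`. -/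
def BPrefers (M M' : A → Option B) (b : B) : Prop :=
  PostMatched M b ∧ ¬ PostMatched M' b

/-- `phi rank M M'` is the number of vertices preferring `M` to `M'`
(both sides vote; posts have all neighbors in a single tie). -/
def phi (rank : A → B → ℕ) (M M' : A → Option B) : ℕ :=
  Nat.card {a : A // APrefers rank M M' a} + Nat.card {b : B // BPrefers M M' b}

/-- `M` is a popular matching of `G` (two-sided votes, one-sided ties model). -/
def Popular (E : A → B → Prop) (rank : A → B → ℕ) (M : A → Option B) : Prop :=
  IsMatching E M ∧ ∀ M', IsMatching E M' → phi rank M' M ≤ phi rank M M'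

/-- The applicants' preference lists are strict: distinct neighbors get distinct ranks. -/
def StrictRanks (E : A → B → Prop) (rank : A → B → ℕ) : Prop :=
  ∀ a b b', E a b → E a b' → rank a b = rank a b' → b = b'

/-- `f a` is applicant `a`'s top-ranked neighbor. -/
def IsTopChoice (E : A → B → Prop) (rank : A → B → ℕ) (f : A → B) : Prop :=
  ∀ a, E a (f a) ∧ ∀ b, E a b → rank a (f a) ≤ rank a b

/-- `rVal E rank F a` is the rank of `a`'s most preferred neighbor outside the
set `F` of top posts, and `⊤` (infinity) if all of `a`'s neighbors lie in `F`. -/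
def rVal (E : A → B → Prop) (rank : A → B → ℕ) (F : Set B) (a : A) : ℕ∞ :=
  sInf {x : ℕ∞ | ∃ b, E a b ∧ b ∉ F ∧ x = (rank a b : ℕ∞)}

/-- A matching `M` together with a partition `⟨P1, P2, P3⟩` of the posts `B` is
well-structured. Here `Set.range f` is the set `F` of top posts. -/
structure WellStructured (E : A → B → Prop) (rank : A → B → ℕ) (f : A → B)
    (M : A → Option B) (P1 P2 P3 : Set B) : Prop where
  union_eq : P1 ∪ P2 ∪ P3 = Set.univ
  disj12 : Disjoint P1 P2
  disj13 : Disjoint P1 P3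
  disj23 : Disjoint P2 P3
  P1_subset_F : P1 ⊆ Set.range f
  P3_disjoint_F : Disjoint P3 (Set.range f)
  matched_P12 : ∀ b ∈ P1 ∪ P2, PostMatched M b
  unmatched_nbrs : ∀ a, M a = none → ∀ b, E a b → b ∈ P1
  pair_P1 : ∀ a b, M a = some b → b ∈ P1 → b = f a ∧ ∀ b', E a b' → b' ∉ P3
  pair_P2 : ∀ a b, M a = some b → b ∈ P2 →
    (∀ b', E a b' → b' ∈ P2 → rank a b ≤ rank a b') ∧
      (rank a b : ℕ∞) ≤ rVal E rank (Set.range f) a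
  pair_P3 : ∀ a b, M a = some b → b ∈ P3 →
    ∀ b', E a b' → b' ∈ P3 → rank a b ≤ rank a b'

/-- The label (the applicant's vote) of an edge `(a, b)` of `G` not belonging to the
matching `M`: it is `+1` if `a` is unmatched in `M` (equivalently, matched to its
dummy last-resort post in the `A`-complete extension `M̂`) or prefers `b` to `M a`,
and `-1` otherwise. -/
def edgeLabel (rank : A → B → ℕ) (M : A → Option B) (a : A) (b : B) : ℤ :=
  match M a with
  | none => 1
  | some b' => if rank a b < rank a b' then 1 else -1

/-- The labels of the non-`M̂` edges `(aseq (i+1), bseq i)` (`i = 0, …, m-1`) along an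
alternating path of `M̂ ⊕ M'` whose `M̂`-edges are `(aseq i, bseq i)` (for `i < m`)
together with the final `M̂`-edge at `aseq m` (to a real post or to its dummy
last-resort post). -/
def pathLabels (rank : A → B → ℕ) (M : A → Option B) {m : ℕ}
    (aseq : Fin (m + 1) → A) (bseq : Fin m → B) : List ℤ :=
  List.ofFn fun i : Fin m => edgeLabel rank M (aseq i.succ) (bseq i)

/-- The height of a partner in `M̂`: posts of `P1`, `P2` and `P3` have heights `2`, `1` and `0`,
and `none`, standing for a dummy last-resort post, has height `1`. -/
def partHeight (P1 P2 : Set B) : Option B → ℤ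
  | none => 1
  | some b => if b ∈ P1 then 2 else if b ∈ P2 then 1 else 0

theorem partHeight_nonneg (P1 P2 : Set B) (o : Option B) : 0 ≤ partHeight P1 P2 o := by
  cases o with
  | none => simp [partHeight]
  | some b => simp only [partHeight]; split_ifs <;> norm_num

theorem edgeLabel_eq_one_or (rank : A → B → ℕ) (M : A → Option B) (a : A) (b : B) :
    edgeLabel rank M a b = 1 ∨ edgeLabel rank M a b = -1 := by
  unfold edgeLabel
  split
  · exact Or.inl rfl
  · split_ifs <;> simp

theorem rVal_le {E : A → B → Prop} {rank : A → B → ℕ} {F : Set B} {a : A} {b : B}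
    (hE : E a b) (hb : b ∉ F) : rVal E rank F a ≤ rank a b :=
  sInf_le ⟨b, hE, hb, rfl⟩

namespace WellStructured

variable {E : A → B → Prop} {rank : A → B → ℕ} {f : A → B} {M : A → Option B} {P1 P2 P3 : Set B}

theorem mem_P3 (hws : WellStructured E rank f M P1 P2 P3) {b : B} (h1 : b ∉ P1) (h2 : b ∉ P2) :
    b ∈ P3 := by
  have hb : b ∈ P1 ∪ P2 ∪ P3 := hws.union_eq ▸ Set.mem_univ b
  simpa [h1, h2] using hb

theorem partHeight_of_not_postMatched (hws : WellStructured E rank f M P1 P2 P3) {b : B}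
    (hb : ¬ PostMatched M b) : partHeight P1 P2 (some b) = 0 := by
  have h1 : b ∉ P1 := fun h => hb (hws.matched_P12 b (Or.inl h))
  have h2 : b ∉ P2 := fun h => hb (hws.matched_P12 b (Or.inr h))
  simp [partHeight, h1, h2]

theorem edgeLabel_le_sub (hws : WellStructured E rank f M P1 P2 P3)
    (htop : IsTopChoice E rank f) {a : A} {b : B} (hE : E a b) :
    edgeLabel rank M a b ≤ partHeight P1 P2 (some b) - partHeight P1 P2 (M a) := by
  cases hMa : M a with
  | none => simp [edgeLabel, hMa, partHeight, hws.unmatched_nbrs a hMa b hE]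
  | some c =>
    simp only [edgeLabel, hMa, partHeight]
    by_cases hc1 : c ∈ P1
    · obtain ⟨rfl, hP3⟩ := hws.pair_P1 a c hMa hc1
      have hle := (htop a).2 b hE
      have hb : b ∈ P1 ∨ b ∈ P2 := by
        by_contra! h
        exact hP3 b hE (hws.mem_P3 h.1 h.2)
      rw [if_neg hle.not_gt, if_pos hc1]
      split_ifs <;> norm_num <;> tauto
    by_cases hc2 : c ∈ P2
    · obtain ⟨hP2, hr⟩ := hws.pair_P2 a c hMa hc2
      rw [if_neg hc1, if_pos hc2]
      by_cases hb1 : b ∈ P1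
      · split_ifs <;> norm_num
      have hle : rank a c ≤ rank a b := by
        by_cases hb2 : b ∈ P2
        · exact hP2 b hE hb2
        · have hF : b ∉ Set.range f :=
            Set.disjoint_left.1 hws.P3_disjoint_F (hws.mem_P3 hb1 hb2)
          exact_mod_cast hr.trans (rVal_le hE hF)
      rw [if_neg hle.not_gt]
      split_ifs <;> norm_num
    · rw [if_neg hc1, if_neg hc2]
      by_cases hb : b ∈ P1 ∨ b ∈ P2
      · split_ifs <;> norm_num <;> tauto
      · push Not at hb
        have hle := hws.pair_P3 a c hMa (hws.mem_P3 hc1 hc2) b hE (hws.mem_P3 hb.1 hb.2)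
        simp [hle.not_gt, hb.1, hb.2]

end WellStructured

theorem sum_eq_count_one_sub_count_neg_one (l : List ℤ) (hl : ∀ x ∈ l, x = 1 ∨ x = -1) :
    l.sum = (l.count 1 : ℤ) - l.count (-1) := by
  induction l with
  | nil => simp
  | cons x l ih =>
    have ih := ih fun y hy => hl y (List.mem_cons_of_mem x hy)
    rcases hl x List.mem_cons_self with rfl | rfl <;>
      simp [ih] <;> ring

/-- Let `(M, ⟨P1, P2, P3⟩)` be well-structured, let `M̂` be its
`A`-complete extension by dummy last-resort posts, and let `M'` be any matching of `G`.
An even-length alternating path of `M̂ ⊕ M'` has the form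
`b0 - aseq 0 - bseq 0 - aseq 1 - ⋯ - aseq m - (M̂ (aseq m))`, where `b0` is matched
in `M'` but unmatched in `M̂`, and the final endpoint is either the dummy last-resort
post of `aseq m` (when `M (aseq m) = none`) or a real post unmatched in `M'`.
In any such path the number of edges labeled `-1` is at least the number of edges
labeled `+1`; and if the endpoint is a dummy last-resort post, the number of edges
labeled `-1` is at least one plus the number of edges labeled `+1`. -/
theorem even_alternating_path_labels
    [Fintype A] [Fintype B]
    (E : A → B → Prop) (rank : A → B → ℕ) (f : A → B)
    (hstrict : StrictRanks E rank) (htop : IsTopChoice E rank f)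
    (M M' : A → Option B) (hM : IsMatching E M) (hM' : IsMatching E M')
    (P1 P2 P3 : Set B) (hws : WellStructured E rank f M P1 P2 P3)
    (m : ℕ) (aseq : Fin (m + 1) → A) (bseq : Fin m → B) (b0 : B)
    (hinj : Function.Injective aseq)
    (hchain : ∀ i : Fin m,
      M (aseq i.castSucc) = some (bseq i) ∧ M' (aseq i.succ) = some (bseq i))
    (hfirst : M' (aseq 0) = some b0)
    (hb0 : ¬ PostMatched M b0)
    (hlast : M (aseq (Fin.last m)) = none ∨
      ∃ bl, M (aseq (Fin.last m)) = some bl ∧ ¬ PostMatched M' bl) :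
    (edgeLabel rank M (aseq 0) b0 :: pathLabels rank M aseq bseq).count 1 ≤
        (edgeLabel rank M (aseq 0) b0 :: pathLabels rank M aseq bseq).count (-1) ∧
      (M (aseq (Fin.last m)) = none →
        (edgeLabel rank M (aseq 0) b0 :: pathLabels rank M aseq bseq).count 1 + 1 ≤
          (edgeLabel rank M (aseq 0) b0 :: pathLabels rank M aseq bseq).count (-1)) := by
  have hsum := sum_eq_count_one_sub_count_neg_one
    (edgeLabel rank M (aseq 0) b0 :: pathLabels rank M aseq bseq) (by
      intro x hx
      rcases List.mem_cons.1 hx with rfl | hx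
      · exact edgeLabel_eq_one_or ..
      · obtain ⟨i, rfl⟩ := (List.mem_ofFn' _ _).1 hx
        exact edgeLabel_eq_one_or ..)
  have hfirst_le := hws.edgeLabel_le_sub htop (hM'.1 _ _ hfirst)
  rw [hws.partHeight_of_not_postMatched hb0] at hfirst_le
  have hrest_le : (pathLabels rank M aseq bseq).sum ≤
      ∑ i : Fin m, (partHeight P1 P2 (M (aseq i.castSucc)) -
        partHeight P1 P2 (M (aseq i.succ))) := by
    rw [pathLabels, List.sum_ofFn]
    refine Finset.sum_le_sum fun i _ => ?_
    rw [(hchain i).1]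
    exact hws.edgeLabel_le_sub htop (hM'.1 _ _ (hchain i).2)
  have htelescope := (Fin.sum_univ_castSucc fun i => partHeight P1 P2 (M (aseq i))).symm.trans
    (Fin.sum_univ_succ fun i => partHeight P1 P2 (M (aseq i)))
  rw [Finset.sum_sub_distrib] at hrest_le
  rw [List.sum_cons] at hsum
  have hend := partHeight_nonneg P1 P2 (M (aseq (Fin.last m)))
  refine ⟨by omega, fun hnone => ?_⟩
  have hdummy : partHeight P1 P2 (M (aseq (Fin.last m))) = 1 := by rw [hnone]; rfl
  omega
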